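/- Given a phrase structure ω-grammar G = (N, T, P, S, 𝓕), there can be constructed a phrase structure ω-grammar G' = (N', T, P', S, 𝓗) all of whose productions are of the forms α → β with α, β ∈ N⁺, or A → a with A ∈ N and a ∈ T, or A → ε with A ∈ N, such that L_{σ,ρ,π}(G) = L_{σ,ρ,π}(G') for every σ ∈ {ran, inf}, ρ ∈ {⊓, ⊆, =}, and π ∈ {l, nl}. -/

import Mathlib

namespace OmegaFormal

/-- σ component of an acceptance mode: `ran` (occurs at least once)
or `inf` (occurs infinitely often). -/
inductive AccSigma | ran | inf
deriving DecidableEq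

/-- ρ component of an acceptance mode: `cap` (nonempty intersection, ⊓),
`sub` (⊆) or `eq` (=). -/
inductive AccRho | cap | sub | eq
deriving DecidableEq

/-- derivation mode: leftmost (`l`) or normal (`nl`). -/
inductive DerivMode | l | nl
deriving DecidableEq

/-- `sigmaSet σ f` is ran(f) resp. inf(f). -/
def sigmaSet {Q : Type _} : AccSigma → (ℕ → Q) → Set Q
  | .ran, f => Set.range f
  | .inf, f => {q | ∀ n : ℕ, ∃ m : ℕ, n ≤ m ∧ f m = q}

/-- the binary relation denoted by ρ. -/
def rhoRel {Q : Type _} : AccRho → Set Q → Set Q → Prop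
  | .cap, A, B => (A ∩ B).Nonempty
  | .sub, A, B => A ⊆ B
  | .eq,  A, B => A = B

/-- f is (σ,ρ)-accepting w.r.t. the set 𝓕 of designated sets. -/
def IsAccepting {Q : Type _} (σ : AccSigma) (ρ : AccRho) (𝓕 : Set (Set Q)) (f : ℕ → Q) : Prop :=
  ∃ F ∈ 𝓕, rhoRel ρ (sigmaSet σ f) F

/-- the finite word `l` coincides with the prefix of the ω-word `u`. -/
def MatchesPrefix {T : Type _} (l : List T) (u : ℕ → T) : Prop :=
  ∀ (k : ℕ) (h : k < l.length), l.get ⟨k, h⟩ = u k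

/-- the maximal terminal prefix of a sentential form. -/
def termPrefix {N T : Type _} : List (N ⊕ T) → List T
  | [] => []
  | (Sum.inl _) :: _ => []
  | (Sum.inr a) :: l => a :: termPrefix l

/-- A phrase structure ω-grammar `G = (N, T, P, S, 𝓕)`:
`N` nonterminals, `T` terminals, `P` named productions `p : lhs p → rhs p`
with `lhs p ∈ N⁺`, `rhs p ∈ (N ∪ T)*`, start symbol, and
production repetition sets `acc ⊆ 2^P`. -/
structure OmegaPSG (T : Type) where
  N : Type
  [fintypeN : Fintype N]
  P : Type
  [fintypeP : Fintype P]
  lhs : P → List N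
  lhs_ne : ∀ p : P, lhs p ≠ []
  rhs : P → List (N ⊕ T)
  start : N
  acc : Set (Set P)

namespace OmegaPSG

variable {T : Type} (G : OmegaPSG T)

/-- one (normal) rewriting step using production p. -/
def Step (p : G.P) (x y : List (G.N ⊕ T)) : Prop :=
  ∃ u v : List (G.N ⊕ T),
    x = u ++ (G.lhs p).map Sum.inl ++ v ∧ y = u ++ G.rhs p ++ v

/-- one leftmost rewriting step: the rewritten occurrence starts at the
leftmost nonterminal, i.e. everything to its left is terminal. -/
def LStep (p : G.P) (x y : List (G.N ⊕ T)) : Prop :=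
  ∃ u v : List (G.N ⊕ T), (∀ s ∈ u, ∃ a : T, s = Sum.inr a) ∧
    x = u ++ (G.lhs p).map Sum.inl ++ v ∧ y = u ++ G.rhs p ++ v

def StepOf : DerivMode → G.P → List (G.N ⊕ T) → List (G.N ⊕ T) → Prop
  | .l => G.LStep
  | .nl => G.Step

/-- `L_{σ,ρ,π}(G)`: ω-words admitting an infinite π-derivation from S whose
growing terminal prefixes spell the word and whose production sequence is
(σ,ρ)-accepting w.r.t. `G.acc`. -/
def Lang (σ : AccSigma) (ρ : AccRho) (π : DerivMode) : Set (ℕ → T) :=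
  {u | ∃ (s : ℕ → List (G.N ⊕ T)) (d : ℕ → G.P),
    s 0 = [Sum.inl G.start] ∧
    (∀ i : ℕ, G.StepOf π (d i) (s i) (s (i + 1))) ∧
    (∀ n : ℕ, ∃ i : ℕ, n ≤ (termPrefix (s i)).length) ∧
    (∀ i : ℕ, MatchesPrefix (termPrefix (s i)) u) ∧
    IsAccepting σ ρ G.acc d}

/-- context-free: every left-hand side is a single nonterminal. -/
def IsCFG : Prop := ∀ p : G.P, (G.lhs p).length = 1

/-- context-sensitive (monotonic): `|β| ≥ |α|` for every production. -/
def IsCSG : Prop := ∀ p : G.P, (G.lhs p).length ≤ (G.rhs p).length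

/-- right linear: productions of the form `A → uB` or `A → u`, `u ∈ T*`. -/
def IsRLG : Prop :=
  ∀ p : G.P, (G.lhs p).length = 1 ∧
    ∃ (w : List T) (B : Option G.N),
      G.rhs p = w.map Sum.inr ++ B.toList.map Sum.inl

/-- `G` is a grammar with `$`-boundary (PSG version): with `$` = `dollar`,
`S` = `S'`, every production has one of the forms
(1) α → β, α,β ∈ N⁺ (N = nonterminals other than `$`, `S`),
(2) S → $α, α ∈ N⁺, (3) $A → a$, (4) A → ε. -/
def HasDollarBoundary (dollar S' : G.N) : Prop :=
  dollar ≠ S' ∧ G.start = S' ∧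
  ∀ p : G.P,
    ((dollar ∉ G.lhs p ∧ S' ∉ G.lhs p) ∧
      ∃ β : List G.N, β ≠ [] ∧ dollar ∉ β ∧ S' ∉ β ∧ G.rhs p = β.map Sum.inl) ∨
    (G.lhs p = [S'] ∧ ∃ α : List G.N, α ≠ [] ∧ dollar ∉ α ∧ S' ∉ α ∧
      G.rhs p = Sum.inl dollar :: α.map Sum.inl) ∨
    (∃ A : G.N, A ≠ dollar ∧ A ≠ S' ∧ G.lhs p = [dollar, A] ∧
      ∃ a : T, G.rhs p = [Sum.inr a, Sum.inl dollar]) ∨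
    (∃ A : G.N, A ≠ dollar ∧ A ≠ S' ∧ G.lhs p = [A] ∧ G.rhs p = [])

/-- `G` is a grammar with `$`-boundary (CSG version): forms (1)-(3) only,
with `|α| ≤ |β|` in form (1). -/
def HasDollarBoundaryCSG (dollar S' : G.N) : Prop :=
  dollar ≠ S' ∧ G.start = S' ∧
  ∀ p : G.P,
    ((dollar ∉ G.lhs p ∧ S' ∉ G.lhs p) ∧
      ∃ β : List G.N, β ≠ [] ∧ dollar ∉ β ∧ S' ∉ β ∧ (G.lhs p).length ≤ β.length ∧
        G.rhs p = β.map Sum.inl) ∨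
    (G.lhs p = [S'] ∧ ∃ α : List G.N, α ≠ [] ∧ dollar ∉ α ∧ S' ∉ α ∧
      G.rhs p = Sum.inl dollar :: α.map Sum.inl) ∨
    (∃ A : G.N, A ≠ dollar ∧ A ≠ S' ∧ G.lhs p = [dollar, A] ∧
      ∃ a : T, G.rhs p = [Sum.inr a, Sum.inl dollar])

end OmegaPSG

/-- `𝓛_{σ,ρ,π}(X)` for the family `X` of ω-grammars over `T` satisfying `C`. -/
def GLang (T : Type) (C : OmegaPSG T → Prop) (σ : AccSigma) (ρ : AccRho) (π : DerivMode) :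
    Set (Set (ℕ → T)) :=
  {L | ∃ G : OmegaPSG T, C G ∧ L = G.Lang σ ρ π}

/-- number of non-ε labels among `b 0, …, b (i-1)`. -/
def someCount {A : Type _} (b : ℕ → Option A) (i : ℕ) : ℕ :=
  ((Finset.range i).filter fun j => (b j).isSome = true).card

/-- the (ε-allowing) label sequence `b` concatenates to the ω-word `u`. -/
def Spells {A : Type _} (b : ℕ → Option A) (u : ℕ → A) : Prop :=
  (∀ n : ℕ, ∃ i : ℕ, n ≤ someCount b i) ∧
  ∀ i : ℕ, ∀ a : A, b i = some a → a = u (someCount b i)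

/-- A finite state ω-automaton `(Q, Σ, δ, q₀, 𝓕)`. -/
structure OmegaFSA (Sig : Type) where
  Q : Type
  [fintypeQ : Fintype Q]
  init : Q
  trans : Q → Option Sig → Q → Prop
  acc : Set (Set Q)

/-- `L_{σ,ρ}(A)` for a finite state ω-automaton. -/
def OmegaFSA.Lang {Sig : Type} (A : OmegaFSA Sig) (σ : AccSigma) (ρ : AccRho) :
    Set (ℕ → Sig) :=
  {u | ∃ (r : ℕ → A.Q) (b : ℕ → Option Sig),
    r 0 = A.init ∧ (∀ i : ℕ, A.trans (r i) (b i) (r (i + 1))) ∧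
    Spells b u ∧ IsAccepting σ ρ A.acc r}

/-- `𝓛_{σ,ρ}(ω-FSA)`. -/
def FSALang (Sig : Type) (σ : AccSigma) (ρ : AccRho) : Set (Set (ℕ → Sig)) :=
  {L | ∃ A : OmegaFSA Sig, L = A.Lang σ ρ}

/-- A pushdown ω-automaton `(Q, Σ, Γ, δ, q₀, Z₀, 𝓕)`. -/
structure OmegaPDA (Sig : Type) where
  Q : Type
  [fintypeQ : Fintype Q]
  Γ : Type
  [fintypeΓ : Fintype Γ]
  init : Q
  Z0 : Γ
  trans : Q → Option Sig → Γ → Q → List Γ → Prop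
  acc : Set (Set Q)

/-- `L_{σ,ρ}(D)` for a pushdown ω-automaton. -/
def OmegaPDA.Lang {Sig : Type} (D : OmegaPDA Sig) (σ : AccSigma) (ρ : AccRho) :
    Set (ℕ → Sig) :=
  {u | ∃ (q : ℕ → D.Q) (st : ℕ → List D.Γ) (b : ℕ → Option Sig),
    q 0 = D.init ∧ st 0 = [D.Z0] ∧
    (∀ i : ℕ, ∃ (Z : D.Γ) (γ rest : List D.Γ),
      st i = Z :: rest ∧ D.trans (q i) (b i) Z (q (i + 1)) γ ∧ st (i + 1) = γ ++ rest) ∧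
    Spells b u ∧ IsAccepting σ ρ D.acc q}

/-- `𝓛_{σ,ρ}(ω-PDA)`. -/
def PDALang (Sig : Type) (σ : AccSigma) (ρ : AccRho) : Set (Set (ℕ → Sig)) :=
  {L | ∃ D : OmegaPDA Sig, L = D.Lang σ ρ}

/-- tape head moves. -/
inductive Move | L | R | S
deriving DecidableEq

def moveHead : Move → ℕ → ℕ
  | .L, n => n - 1
  | .R, n => n + 1
  | .S, n => n

/-- A single-tape Turing ω-machine `(Q, Σ, Γ, δ, q₀, 𝓕)` (Σ ⊆ Γ via `embed`). -/
structure OmegaTM (Sig : Type) where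
  Q : Type
  [fintypeQ : Fintype Q]
  Γ : Type
  [fintypeΓ : Fintype Γ]
  embed : Sig → Γ
  embed_inj : Function.Injective embed
  init : Q
  trans : Q → Γ → Q → Γ → Move → Prop
  acc : Set (Set Q)

/-- `L_{σ,ρ}(M)`: ω-words admitting a complete non-oscillating run whose state
sequence is (σ,ρ)-accepting. -/
def OmegaTM.Lang {Sig : Type} (M : OmegaTM Sig) (σ : AccSigma) (ρ : AccRho) :
    Set (ℕ → Sig) :=
  {u | ∃ (q : ℕ → M.Q) (tape : ℕ → ℕ → M.Γ) (pos : ℕ → ℕ),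
    q 0 = M.init ∧ (∀ n : ℕ, tape 0 n = M.embed (u n)) ∧ pos 0 = 0 ∧
    (∀ i : ℕ, ∃ (g : M.Γ) (m : Move),
      M.trans (q i) (tape i (pos i)) (q (i + 1)) g m ∧
      tape (i + 1) = Function.update (tape i) (pos i) g ∧
      pos (i + 1) = moveHead m (pos i)) ∧
    (∀ n : ℕ, ∃ i : ℕ, n ≤ pos i) ∧
    (∀ n : ℕ, ∃ i0 : ℕ, ∀ i : ℕ, i0 ≤ i → pos i ≠ n) ∧
    IsAccepting σ ρ M.acc q}

/-- `𝓛_{σ,ρ}(ω-TM)`. -/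
def TMLang (Sig : Type) (σ : AccSigma) (ρ : AccRho) : Set (Set (ℕ → Sig)) :=
  {L | ∃ M : OmegaTM Sig, L = M.Lang σ ρ}

/-- An m-tape Turing ω-machine. -/
structure OmegaMTM (m : ℕ) (Sig : Type) where
  Q : Type
  [fintypeQ : Fintype Q]
  Γ : Type
  [fintypeΓ : Fintype Γ]
  embed : Sig → Γ
  embed_inj : Function.Injective embed
  blank : Γ
  init : Q
  trans : Q → (Fin m → Γ) → Q → (Fin m → Γ) → (Fin m → Move) → Prop
  acc : Set (Set Q)

/-- `L_{σ,ρ}(M)` for an m-tape Turing ω-machine (`hm : 0 < m`; the input is on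
the first tape, the other tapes are initially blank; the run must be complete
and non-oscillating on the first tape). -/
def OmegaMTM.Lang {m : ℕ} {Sig : Type} (M : OmegaMTM m Sig) (hm : 0 < m)
    (σ : AccSigma) (ρ : AccRho) : Set (ℕ → Sig) :=
  {u | ∃ (q : ℕ → M.Q) (tape : ℕ → Fin m → ℕ → M.Γ) (pos : ℕ → Fin m → ℕ),
    q 0 = M.init ∧
    (∀ n : ℕ, tape 0 ⟨0, hm⟩ n = M.embed (u n)) ∧
    (∀ j : Fin m, j ≠ ⟨0, hm⟩ → ∀ n : ℕ, tape 0 j n = M.blank) ∧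
    (∀ j : Fin m, pos 0 j = 0) ∧
    (∀ i : ℕ, ∃ (g : Fin m → M.Γ) (mv : Fin m → Move),
      M.trans (q i) (fun j => tape i j (pos i j)) (q (i + 1)) g mv ∧
      (∀ j : Fin m, tape (i + 1) j = Function.update (tape i j) (pos i j) (g j)) ∧
      (∀ j : Fin m, pos (i + 1) j = moveHead (mv j) (pos i j))) ∧
    (∀ n : ℕ, ∃ i : ℕ, n ≤ pos i ⟨0, hm⟩) ∧
    (∀ n : ℕ, ∃ i0 : ℕ, ∀ i : ℕ, i0 ≤ i → pos i ⟨0, hm⟩ ≠ n) ∧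
    IsAccepting σ ρ M.acc q}

/-- `𝓛_{σ,ρ}(m-ω-TM)`. -/
def MTMLang (Sig : Type) (m : ℕ) (hm : 0 < m) (σ : AccSigma) (ρ : AccRho) :
    Set (Set (ℕ → Sig)) :=
  {L | ∃ M : OmegaMTM m Sig, L = M.Lang hm σ ρ}

/-- the ω-language `{aⁿbⁿ | n ≥ 1}^ω` over the alphabet `Bool`
(`false` = a, `true` = b). -/
def abLang : Set (ℕ → Bool) :=
  {u | ∃ n : ℕ → ℕ, (∀ i : ℕ, 1 ≤ n i) ∧
    ∀ i k : ℕ, k < 2 * n i →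
      u ((∑ j ∈ Finset.range i, 2 * n j) + k) = decide (n i ≤ k)}

end OmegaFormal
open OmegaFormal

namespace OmegaFormal

/-! ### Words and terminal prefixes -/

theorem MatchesPrefix.of_prefix {T : Type*} {l l' : List T} {u : ℕ → T}
    (h : MatchesPrefix l u) (hl : l' <+: l) : MatchesPrefix l' u := by
  intro k hk
  have h1 := h k (hk.trans_le hl.length_le)
  simp only [List.get_eq_getElem] at h1 ⊢
  rw [← h1]
  exact hl.getElem hk

theorem termPrefix_append_inl_prefix {N T : Type*} (u v w : List (N ⊕ T)) (n : N) :
    termPrefix (u ++ Sum.inl n :: v) <+: termPrefix (u ++ w) := by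
  induction u with
  | nil => simp [termPrefix]
  | cons x u ih =>
    rcases x with x | a
    · simp [termPrefix]
    · simpa [termPrefix] using ih

/-! ### Sequences of natural numbers and stuttering sequences -/

/-- An eventually non-increasing sequence of naturals strictly decreases only finitely often. -/
theorem eventually_not_of_decreasing (c : ℕ → ℕ) (A : ℕ → Prop) :
    ∀ (m N : ℕ), c N ≤ m → (∀ i, N ≤ i → c (i + 1) ≤ c i) →
      (∀ i, N ≤ i → A i → c (i + 1) < c i) → ∃ M, ∀ i, M ≤ i → ¬ A i := by
  intro m
  induction m with
  | zero =>
    intro N h0 hle hlt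
    have hz : ∀ i, N ≤ i → c i = 0 := by
      intro i hi
      induction i, hi using Nat.le_induction with
      | base => omega
      | succ i hi ih => have := hle i hi; omega
    refine ⟨N, fun i hi hA => ?_⟩
    have := hlt i hi hA
    have := hz i hi
    omega
  | succ m ih =>
    intro N h0 hle hlt
    by_cases hex : ∃ i, N ≤ i ∧ A i
    · obtain ⟨i, hi, hA⟩ := hex
      have hm : c i ≤ c N := by
        clear hA
        induction i, hi using Nat.le_induction with
        | base => exact le_rfl
        | succ i hi ih => exact (hle i hi).trans ih
      have := hlt i hi hA
      exact ih (i + 1) (by omega) (fun j hj => hle j (by omega)) (fun j hj => hlt j (by omega))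
    · push Not at hex
      exact ⟨N, hex⟩

/-- A sequence that only changes at indices satisfying `p` is constant up to the next one. -/
theorem eq_nth_count_of_stutter {α : Type*} (p : ℕ → Prop) [DecidablePred p] (x : ℕ → α)
    (hp : (Set.ofPred p).Infinite) (hx : ∀ i, ¬ p i → x (i + 1) = x i) (i : ℕ) :
    x (Nat.nth p (Nat.count p i)) = x i := by
  have key : ∀ k, i ≤ k → (∀ j, i ≤ j → j < k → ¬ p j) → x k = x i := by
    intro k hk
    induction k, hk using Nat.le_induction with
    | base => intro _; rfl
    | succ k hk ih =>
      intro h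
      rw [hx k (h k hk k.lt_succ_self), ih fun j h1 h2 => h j h1 (h2.trans k.lt_succ_self)]
  refine key _ (Nat.le_nth_count hp i) fun j h1 h2 hj => ?_
  have h3 := Nat.count_monotone p h1
  have h4 := Nat.nth_monotone hp h3
  rw [Nat.nth_count hj] at h4
  omega

namespace OmegaPSG

variable {T : Type} (G : OmegaPSG T)

theorem StepOf.step {G : OmegaPSG T} {π : DerivMode} {p : G.P} {x y : List (G.N ⊕ T)}
    (h : G.StepOf π p x y) : G.Step p x y := by
  cases π with
  | l => obtain ⟨u, v, -, h⟩ := h; exact ⟨u, v, h⟩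
  | nl => exact h

theorem stepOf_iff {G : OmegaPSG T} {π : DerivMode} {p : G.P} {x y : List (G.N ⊕ T)} :
    G.StepOf π p x y ↔ ∃ u v : List (G.N ⊕ T),
      (π = .l → ∀ s ∈ u, ∃ a : T, s = Sum.inr a) ∧
      x = u ++ (G.lhs p).map Sum.inl ++ v ∧ y = u ++ G.rhs p ++ v := by
  cases π <;> simp [StepOf, Step, LStep]

theorem Step.termPrefix_prefix {G : OmegaPSG T} {p : G.P} {x y : List (G.N ⊕ T)}
    (h : G.Step p x y) : termPrefix x <+: termPrefix y := by
  obtain ⟨u, v, rfl, rfl⟩ := h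
  obtain ⟨n, l, hl⟩ := List.exists_cons_of_ne_nil (G.lhs_ne p)
  simpa [hl] using termPrefix_append_inl_prefix u (l.map Sum.inl ++ v) (G.rhs p ++ v) n

/-! ### The normal form grammar -/

/-- Nonterminals of the normal form: those of `G`, and for every production `p` a delayed
terminal `(p, some a)` and a delayed empty word `(p, none)`. -/
abbrev NFN : Type := G.N ⊕ (G.P × Option T)

/-- Replace a terminal in the right-hand side of `p` by the corresponding delayed terminal. -/
def nfLift (p : G.P) : G.N ⊕ T → G.NFN
  | .inl n => .inl n
  | .inr a => .inr (p, some a)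

/-- Right-hand side, over nonterminals only, of the production simulating `p`. -/
def nfRhs (p : G.P) : List G.NFN :=
  match G.rhs p with
  | [] => [.inr (p, none)]
  | x :: l => (x :: l).map (G.nfLift p)

/-- The normal form of `G`: the productions of `G` with terminals (and empty right-hand sides)
delayed and tagged by the production they come from, and one production resolving every
delayed symbol. -/
abbrev nf [Fintype T] : OmegaPSG T :=
  haveI := G.fintypeN
  haveI := G.fintypeP
  { N := G.NFN
    P := G.P ⊕ (G.P × Option T)
    lhs := Sum.elim (fun p => (G.lhs p).map Sum.inl) (fun e => [Sum.inr e])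
    lhs_ne := by
      rintro (p | e)
      · simpa using G.lhs_ne p
      · simp
    rhs := Sum.elim (fun p => (G.nfRhs p).map Sum.inl) (fun e => e.2.toList.map Sum.inr)
    start := Sum.inl G.start
    acc := {H | ∃ F ∈ G.acc, (∀ p, Sum.inl p ∈ H ↔ p ∈ F) ∧ ∀ q o, Sum.inr (q, o) ∈ H → q ∈ F} }

/-- The symbol of `G` represented by a symbol of the normal form, if any. -/
def nfSym : G.NFN ⊕ T → Option (G.N ⊕ T)
  | .inl (.inl n) => some (.inl n)
  | .inl (.inr (_, o)) => o.map Sum.inr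
  | .inr a => some (.inr a)

/-- The sentential form of `G` represented by one of the normal form. -/
def nfForm (x : List (G.NFN ⊕ T)) : List (G.N ⊕ T) := x.filterMap G.nfSym

@[simp] theorem nfForm_append (x y : List (G.NFN ⊕ T)) :
    G.nfForm (x ++ y) = G.nfForm x ++ G.nfForm y := List.filterMap_append ..

@[simp] theorem nfForm_nil : G.nfForm [] = [] := rfl

@[simp] theorem nfForm_inl_inl (n : G.N) (x : List (G.NFN ⊕ T)) :
    G.nfForm (.inl (.inl n) :: x) = .inl n :: G.nfForm x := rfl

@[simp] theorem nfForm_inr (a : T) (x : List (G.NFN ⊕ T)) :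
    G.nfForm (.inr a :: x) = .inr a :: G.nfForm x := rfl

@[simp] theorem nfForm_none (p : G.P) (x : List (G.NFN ⊕ T)) :
    G.nfForm (.inl (.inr (p, none)) :: x) = G.nfForm x := rfl

@[simp] theorem nfForm_some (p : G.P) (a : T) (x : List (G.NFN ⊕ T)) :
    G.nfForm (.inl (.inr (p, some a)) :: x) = .inr a :: G.nfForm x := rfl

theorem nfForm_lhs (l : List G.N) :
    G.nfForm (l.map (fun n => Sum.inl (Sum.inl n))) = l.map Sum.inl := by
  induction l <;> simp_all

theorem nfForm_map_nfLift (p : G.P) (l : List (G.N ⊕ T)) :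
    G.nfForm ((l.map (G.nfLift p)).map Sum.inl) = l := by
  induction l with
  | nil => rfl
  | cons x l ih => rcases x with n | a <;> simpa [nfLift] using ih

theorem nfForm_nfRhs (p : G.P) : G.nfForm ((G.nfRhs p).map Sum.inl) = G.rhs p := by
  unfold nfRhs
  split
  · next h => simp [h]
  · next x l h => rw [h, nfForm_map_nfLift]

theorem termPrefix_prefix_nfForm (x : List (G.NFN ⊕ T)) :
    termPrefix x <+: termPrefix (G.nfForm x) := by
  induction x with
  | nil => simp [termPrefix]
  | cons s x ih =>
    rcases s with s | a
    · simp [termPrefix]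
    · simpa [termPrefix] using ih

theorem nfForm_terminals {u : List (G.NFN ⊕ T)} (h : ∀ s ∈ u, ∃ a : T, s = Sum.inr a) :
    ∀ s ∈ G.nfForm u, ∃ a : T, s = Sum.inr a := by
  intro s hs
  obtain ⟨x, hx, hxs⟩ := List.mem_filterMap.1 hs
  obtain ⟨a, rfl⟩ := h x hx
  exact ⟨a, by simpa [nfSym] using hxs.symm⟩

section Steps

variable [Fintype T] {G}

theorem nf_stepOf_inl {π : DerivMode} {p : G.P} {x y : List (G.NFN ⊕ T)}
    (h : G.nf.StepOf π (Sum.inl p) x y) : G.StepOf π p (G.nfForm x) (G.nfForm y) := by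
  obtain ⟨u, v, hu, rfl, rfl⟩ := stepOf_iff.1 h
  refine stepOf_iff.2 ⟨G.nfForm u, G.nfForm v, fun hπ => G.nfForm_terminals (hu hπ), ?_, ?_⟩
  · have := G.nfForm_lhs (G.lhs p)
    simp [nf, Function.comp_def, this]
  · have := G.nfForm_nfRhs p
    simp [nf, this]

theorem nf_step_inr_iff {e : G.P × Option T} {x y : List (G.NFN ⊕ T)} :
    G.nf.Step (Sum.inr e) x y ↔ ∃ u v : List (G.NFN ⊕ T),
      x = u ++ Sum.inl (Sum.inr e) :: v ∧ y = u ++ e.2.toList.map Sum.inr ++ v := by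
  simp [Step, nf]

theorem nfForm_eq_of_nf_step_inr {e : G.P × Option T} {x y : List (G.NFN ⊕ T)}
    (h : G.nf.Step (Sum.inr e) x y) : G.nfForm y = G.nfForm x := by
  obtain ⟨u, v, rfl, rfl⟩ := nf_step_inr_iff.1 h
  rcases e with ⟨p, _ | a⟩ <;> simp

end Steps

/-! ### Counting delayed symbols -/

open Classical in
/-- Weight of a symbol: one if it is delayed by a production satisfying `R`. -/
noncomputable def nfWeight (R : G.P → Prop) : G.NFN ⊕ T → ℕ
  | .inl (.inr (q, _)) => if R q then 1 else 0
  | _ => 0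

/-- Number of symbols delayed by a production satisfying `R`. -/
noncomputable def nfCount (R : G.P → Prop) (x : List (G.NFN ⊕ T)) : ℕ :=
  (x.map (G.nfWeight R)).sum

section Count

variable {G} {R : G.P → Prop}

theorem nfCount_append (x y : List (G.NFN ⊕ T)) :
    G.nfCount R (x ++ y) = G.nfCount R x + G.nfCount R y := by
  simp [nfCount]

theorem nfCount_lhs (l : List G.N) :
    G.nfCount R (l.map (fun n => Sum.inl (Sum.inl n))) = 0 := by
  induction l <;> simp_all [nfCount, nfWeight]

theorem nfCount_nfRhs {p : G.P} (hp : ¬ R p) :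
    G.nfCount R ((G.nfRhs p).map Sum.inl) = 0 := by
  have key : ∀ l : List (G.N ⊕ T), G.nfCount R ((l.map (G.nfLift p)).map Sum.inl) = 0 := by
    intro l
    induction l with
    | nil => rfl
    | cons x l ih =>
      rcases x with n | a <;> simp_all [nfCount, nfWeight, nfLift]
  unfold nfRhs
  split
  · simp [nfCount, nfWeight, hp]
  · exact key _

variable [Fintype T]

theorem nfCount_step_inl {p : G.P} {x y : List (G.NFN ⊕ T)} (hp : ¬ R p)
    (h : G.nf.Step (Sum.inl p) x y) : G.nfCount R y = G.nfCount R x := by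
  obtain ⟨u, v, rfl, rfl⟩ := h
  have h1 := nfCount_lhs (R := R) (G.lhs p)
  have h2 := nfCount_nfRhs hp
  simp only [nf, Sum.elim_inl, List.map_map, Function.comp_def] at h2 ⊢
  simp only [nfCount_append, h1, h2]

open Classical in
theorem nfCount_step_inr {e : G.P × Option T} {x y : List (G.NFN ⊕ T)}
    (h : G.nf.Step (Sum.inr e) x y) :
    G.nfCount R y + (if R e.1 then 1 else 0) = G.nfCount R x := by
  obtain ⟨u, v, rfl, rfl⟩ := nf_step_inr_iff.1 h
  rcases e with ⟨q, _ | a⟩ <;> simp [nfCount, nfWeight] <;> omega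

/-- If productions satisfying `R` are eventually not applied, their delayed symbols are
eventually not resolved any more. -/
theorem nf_eventually_not_inr {s : ℕ → List (G.NFN ⊕ T)} {d : ℕ → G.nf.P}
    (hs : ∀ i, G.nf.Step (d i) (s i) (s (i + 1))) {N : ℕ}
    (hN : ∀ i, N ≤ i → ∀ p, R p → d i ≠ Sum.inl p) :
    ∃ M, ∀ i, M ≤ i → ∀ e : G.P × Option T, R e.1 → d i ≠ Sum.inr e := by
  obtain ⟨M, hM⟩ := eventually_not_of_decreasing (fun i => G.nfCount R (s i))
    (fun i => ∃ e : G.P × Option T, R e.1 ∧ d i = Sum.inr e) _ N le_rfl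
    (by
      intro i hi
      have h1 := hs i
      rcases hd : d i with p | e
      · rw [hd] at h1
        exact (nfCount_step_inl (fun hR => hN i hi p hR hd) h1).le
      · rw [hd] at h1
        have := nfCount_step_inr (R := R) h1
        omega)
    (by
      rintro i hi ⟨e, hR, hd⟩
      have h1 := hs i
      rw [hd] at h1
      have := nfCount_step_inr (R := R) h1
      rw [if_pos hR] at this
      omega)
  exact ⟨M, fun i hi e hR hd => hM i hi ⟨e, hR, hd⟩⟩

theorem nf_exists_inl {s : ℕ → List (G.NFN ⊕ T)} {d : ℕ → G.nf.P}
    (hs : ∀ i, G.nf.Step (d i) (s i) (s (i + 1))) (N : ℕ) :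
    ∃ i, N ≤ i ∧ ∃ p, d i = Sum.inl p := by
  by_contra! hcon
  obtain ⟨M, hM⟩ := nf_eventually_not_inr (R := fun _ => True) hs
    (N := N) (fun i hi p _ => hcon i hi p)
  rcases hd : d (max M N) with p | e
  · exact hcon _ (le_max_right _ _) p hd
  · exact hM _ (le_max_left _ _) e trivial hd

/-- Whenever a delayed symbol is resolved (infinitely often), its production is applied
(infinitely often). -/
theorem nf_sigmaSet_inr {s : ℕ → List (G.NFN ⊕ T)} {d : ℕ → G.nf.P}
    (h0 : s 0 = [Sum.inl (Sum.inl G.start)])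
    (hs : ∀ i, G.nf.Step (d i) (s i) (s (i + 1))) (σ : AccSigma) {q : G.P} {o : Option T}
    (h : Sum.inr (q, o) ∈ sigmaSet σ d) : Sum.inl q ∈ sigmaSet σ d := by
  cases σ with
  | ran =>
    obtain ⟨j, hj⟩ := h
    by_contra hcon
    have hne : ∀ i, d i ≠ Sum.inl q := fun i hi => hcon ⟨i, hi⟩
    have hz : ∀ i, G.nfCount (· = q) (s i) = 0 := by
      intro i
      induction i with
      | zero => simp [h0, nfCount, nfWeight]
      | succ i ih =>
        have h1 := hs i
        rcases hd : d i with p | e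
        · rw [hd] at h1
          rw [nfCount_step_inl (R := (· = q)) (fun hp : p = q => hne i (by rw [hd, hp])) h1, ih]
        · rw [hd] at h1
          have := nfCount_step_inr (R := (· = q)) h1
          omega
    have h1 := hs j
    rw [hj] at h1
    have h2 := nfCount_step_inr (R := (· = q)) h1
    simp [hz] at h2
  | inf =>
    intro N
    by_contra! hcon
    obtain ⟨M, hM⟩ := nf_eventually_not_inr (R := (· = q)) hs (N := N)
      (by rintro i hi p rfl; exact hcon i hi)
    obtain ⟨m, hm, hd⟩ := h M
    exact hM m hm (q, o) rfl hd

/-- Acceptance in the normal form, in terms of the productions of `G` applied. -/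
theorem nf_accepting_iff (ρ : AccRho) {D' : Set G.nf.P} {D : Set G.P}
    (h1 : ∀ p, Sum.inl p ∈ D' ↔ p ∈ D) (h2 : ∀ q o, Sum.inr (q, o) ∈ D' → q ∈ D) :
    (∃ H ∈ G.nf.acc, rhoRel ρ D' H) ↔ ∃ F ∈ G.acc, rhoRel ρ D F := by
  constructor
  · rintro ⟨H, ⟨F, hF, hH1, hH2⟩, h⟩
    refine ⟨F, hF, ?_⟩
    cases ρ with
    | cap =>
      obtain ⟨p | ⟨q, o⟩, hD, hH⟩ := h
      · exact ⟨p, (h1 p).1 hD, (hH1 p).1 hH⟩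
      · exact ⟨q, h2 q o hD, hH2 q o hH⟩
    | sub => exact fun p hp => (hH1 p).1 (h ((h1 p).2 hp))
    | eq =>
      have h : D' = H := h
      subst h
      exact Set.ext fun p => (h1 p).symm.trans (hH1 p)
  · rintro ⟨F, hF, h⟩
    cases ρ with
    | cap =>
      obtain ⟨p, hD, hp⟩ := h
      refine ⟨{x | ∃ q ∈ F, x = Sum.inl q}, ⟨F, hF, fun p => ?_, fun q o => ?_⟩,
        Sum.inl p, (h1 p).2 hD, p, hp, rfl⟩
      · simp
      · simp
    | sub =>
      refine ⟨{x | Sum.elim id Prod.fst x ∈ F}, ⟨F, hF, fun p => Iff.rfl, fun q o => id⟩, ?_⟩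
      rintro (p | ⟨q, o⟩) hx
      · exact h ((h1 p).1 hx)
      · exact h (h2 q o hx)
    | eq =>
      have h : D = F := h
      subst h
      exact ⟨D', ⟨D, hF, h1, h2⟩, rfl⟩

end Count

/-! ### From the normal form back to `G` -/

section

variable [Fintype T] {G}

open Classical in
theorem nf_lang_subset (σ : AccSigma) (ρ : AccRho) (π : DerivMode) :
    G.nf.Lang σ ρ π ⊆ G.Lang σ ρ π := by
  rintro w ⟨s, d, h0, hs, hgrow, hmatch, hacc⟩
  have hs' : ∀ i, G.nf.Step (d i) (s i) (s (i + 1)) := fun i => (hs i).step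
  let p : ℕ → Prop := fun i => ∃ q, d i = Sum.inl q
  have hstut : ∀ i, ¬ p i → G.nfForm (s (i + 1)) = G.nfForm (s i) := by
    intro i hi
    have h1 := hs' i
    rcases hd : d i with q | e
    · exact absurd ⟨q, hd⟩ hi
    · rw [hd] at h1
      exact nfForm_eq_of_nf_step_inr h1
  have hp : (Set.ofPred p).Infinite := by
    refine Set.infinite_of_forall_exists_gt fun N => ?_
    obtain ⟨i, hi, hpi⟩ := nf_exists_inl hs' (N + 1)
    exact ⟨i, hpi, hi⟩
  have hnth : ∀ n, p (Nat.nth p n) := Nat.nth_mem_of_infinite hp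
  choose dG hdG using hnth
  have hform := eq_nth_count_of_stutter p (fun i => G.nfForm (s i)) hp hstut
  have hmono : ∀ i j, i ≤ j → termPrefix (G.nfForm (s i)) <+: termPrefix (G.nfForm (s j)) := by
    intro i j hij
    induction j, hij using Nat.le_induction with
    | base => exact List.prefix_rfl
    | succ j _ ih =>
      refine ih.trans ?_
      by_cases hj : p j
      · obtain ⟨q, hq⟩ := hj
        have h1 := hs j
        rw [hq] at h1
        exact (nf_stepOf_inl h1).step.termPrefix_prefix
      · rw [hstut j hj]
  refine ⟨fun n => G.nfForm (s (Nat.nth p n)), dG, ?_, ?_, ?_, ?_, ?_⟩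
  · have := hform 0
    simp only [Nat.count_zero] at this
    dsimp only
    rw [this, h0]
    rfl
  · intro n
    have h1 := hs (Nat.nth p n)
    rw [hdG n] at h1
    have h2 := nf_stepOf_inl h1
    have h3 := hform (Nat.nth p n + 1)
    rw [Nat.count_succ, Nat.count_nth_of_infinite hp, if_pos (Nat.nth_mem_of_infinite hp n)] at h3
    dsimp only at h3 ⊢
    rw [h3]
    exact h2
  · intro n
    obtain ⟨i, hi⟩ := hgrow n
    refine ⟨Nat.count p i, ?_⟩
    have h3 := hform i
    dsimp only at h3 ⊢
    rw [h3]
    exact hi.trans (G.termPrefix_prefix_nfForm (s i)).length_le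
  · intro n
    obtain ⟨m, hm⟩ := hgrow (termPrefix (G.nfForm (s (Nat.nth p n)))).length
    refine (hmatch m).of_prefix ?_
    exact List.prefix_of_prefix_length_le (hmono _ (max (Nat.nth p n) m) (le_max_left _ _))
      ((G.termPrefix_prefix_nfForm (s m)).trans (hmono m _ (le_max_right _ _))) hm
  · have h1 : ∀ q, Sum.inl q ∈ sigmaSet σ d ↔ q ∈ sigmaSet σ dG := by
      intro q
      have hcount : ∀ i, d i = Sum.inl q → dG (Nat.count p i) = q := by
        intro i hi
        have h3 := hdG (Nat.count p i)
        rw [Nat.nth_count (p := p) ⟨q, hi⟩, hi] at h3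
        exact (Sum.inl.inj h3).symm
      cases σ with
      | ran =>
        constructor
        · rintro ⟨i, hi⟩
          exact ⟨_, hcount i hi⟩
        · rintro ⟨n, rfl⟩
          exact ⟨_, hdG n⟩
      | inf =>
        constructor
        · intro h n
          obtain ⟨m, hm, hd⟩ := h (Nat.nth p n)
          refine ⟨_, ?_, hcount m hd⟩
          rw [← Nat.count_nth_of_infinite hp n]
          exact Nat.count_monotone p hm
        · intro h n
          obtain ⟨m, hm, rfl⟩ := h n
          exact ⟨_, hm.trans ((Nat.nth_strictMono hp).le_apply), hdG m⟩
    exact (nf_accepting_iff ρ h1 fun q o h => (h1 q).1 (nf_sigmaSet_inr h0 hs' σ h)).1 hacc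

end

/-! ### Simulating `G` in the normal form -/

/-- No delayed empty word occurs. -/
def NFGood (x : List (G.NFN ⊕ T)) : Prop := ∀ p, Sum.inl (Sum.inr (p, none)) ∉ x

/-- No delayed symbol occurs before the first nonterminal of `G`. -/
def NFAdvanced : List (G.NFN ⊕ T) → Prop
  | [] => True
  | .inl (.inl _) :: _ => True
  | .inl (.inr _) :: _ => False
  | .inr _ :: x => NFAdvanced x

/-- Sentential forms reached by the simulation: at most one delayed empty word is pending, in a
position where mode `π` may rewrite it. -/
def NFInv (π : DerivMode) (x : List (G.NFN ⊕ T)) : Prop :=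
  G.NFGood x ∨ ∃ u v p, x = u ++ Sum.inl (Sum.inr (p, none)) :: v ∧
    (π = .l → ∀ s ∈ u, ∃ a : T, s = Sum.inr a) ∧ G.NFGood (u ++ v)

section

variable {G}

theorem NFAdvanced.termPrefix_nfForm {x : List (G.NFN ⊕ T)} (h : G.NFAdvanced x) :
    termPrefix (G.nfForm x) = termPrefix x := by
  induction x with
  | nil => rfl
  | cons s x ih =>
    rcases s with (n | e) | a
    · rfl
    · exact h.elim
    · simpa [termPrefix] using ih h

theorem NFAdvanced.terminals {u v : List (G.NFN ⊕ T)} (h : G.NFAdvanced (u ++ v))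
    (hu : ∀ s ∈ G.nfForm u, ∃ a : T, s = Sum.inr a) : ∀ s ∈ u, ∃ a : T, s = Sum.inr a := by
  induction u with
  | nil => simp
  | cons s u ih =>
    rcases s with (n | e) | a
    · obtain ⟨a, ha⟩ := hu (Sum.inl n) (by simp)
      cases ha
    · exact h.elim
    · simp only [List.mem_cons, forall_eq_or_imp]
      exact ⟨⟨a, rfl⟩, ih h fun s hs => hu s (by simp [hs])⟩

theorem exists_delayed_of_not_nfAdvanced {x : List (G.NFN ⊕ T)} (h : ¬ G.NFAdvanced x) :
    ∃ u v e, x = u ++ Sum.inl (Sum.inr e) :: v ∧ ∀ s ∈ u, ∃ a : T, s = Sum.inr a := by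
  induction x with
  | nil => exact absurd trivial h
  | cons s x ih =>
    rcases s with (n | e) | a
    · exact absurd trivial h
    · exact ⟨[], x, e, rfl, by simp⟩
    · obtain ⟨u, v, e, rfl, hu⟩ := ih h
      exact ⟨Sum.inr a :: u, v, e, rfl, by simpa using hu⟩

theorem eq_map_of_nfForm_eq {x : List (G.NFN ⊕ T)} (hx : G.NFGood x) {l : List G.N}
    (h : G.nfForm x = l.map Sum.inl) : x = l.map (fun n => Sum.inl (Sum.inl n)) := by
  induction x generalizing l with
  | nil => simpa using h.symm
  | cons s x ih =>
    have hx' : G.NFGood x := fun p hp => hx p (List.mem_cons_of_mem _ hp)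
    rcases s with (n | ⟨p, _ | a⟩) | a
    · cases l with
      | nil => simp at h
      | cons m l =>
        simp only [nfForm_inl_inl, List.map_cons, List.cons.injEq, Sum.inl.injEq] at h
        simp [h.1, ih hx' h.2]
    · exact absurd List.mem_cons_self (hx p)
    · cases l <;> simp at h
    · cases l <;> simp at h

theorem nfGood_nfRhs {p : G.P} (h : G.rhs p ≠ []) : G.NFGood ((G.nfRhs p).map Sum.inl) := by
  intro q hq
  unfold nfRhs at hq
  split at hq
  · contradiction
  · obtain ⟨x, hx, he⟩ := List.mem_map.1 hq
    obtain ⟨y, hy, rfl⟩ := List.mem_map.1 hx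
    rcases y with n | a <;> simp [nfLift] at he

theorem nfGood_append {x y : List (G.NFN ⊕ T)} :
    G.NFGood (x ++ y) ↔ G.NFGood x ∧ G.NFGood y := by
  simp only [NFGood, List.mem_append, not_or, forall_and]

variable [Fintype T]

/-- One step of the simulation: resolve a pending delayed symbol, or else simulate the given
step of `G`. -/
theorem nf_simulate {π : DerivMode} {p : G.P} {x : List (G.NFN ⊕ T)} {y : List (G.N ⊕ T)}
    (hinv : G.NFInv π x) (h : G.StepOf π p (G.nfForm x) y) :
    (∃ e x', G.nf.StepOf π (Sum.inr e) x x' ∧ G.nfForm x' = G.nfForm x ∧ G.NFInv π x') ∨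
    (∃ x', G.nf.StepOf π (Sum.inl p) x x' ∧ G.nfForm x' = y ∧ G.NFInv π x' ∧
      termPrefix x = termPrefix (G.nfForm x)) := by
  rcases hinv with hgood | ⟨u, v, q, rfl, hu, hgood⟩
  · by_cases hadv : G.NFAdvanced x
    · right
      obtain ⟨u, v, hu, hx, rfl⟩ := stepOf_iff.1 h
      obtain ⟨uα, v', rfl, huα, rfl⟩ := List.filterMap_eq_append_iff.1 hx
      obtain ⟨u', α, rfl, rfl, hα⟩ := List.filterMap_eq_append_iff.1 huα
      rw [nfGood_append, nfGood_append] at hgood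
      have hα' := eq_map_of_nfForm_eq hgood.1.2 hα
      have hu' : π = .l → ∀ s ∈ u', ∃ a : T, s = Sum.inr a := by
        intro hπ
        rw [List.append_assoc] at hadv
        exact hadv.terminals (hu hπ)
      refine ⟨u' ++ (G.nfRhs p).map Sum.inl ++ v', ?_, ?_, ?_, hadv.termPrefix_nfForm.symm⟩
      · refine stepOf_iff.2 ⟨u', v', hu', ?_, rfl⟩
        simp [nf, hα', Function.comp_def]
      · rw [nfForm_append, nfForm_append, nfForm_nfRhs]
        rfl
      · by_cases hr : G.rhs p = []
        · right
          refine ⟨u', v', p, ?_, hu', nfGood_append.2 ⟨hgood.1.1, hgood.2⟩⟩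
          simp [nfRhs, hr]
        · left
          rw [nfGood_append, nfGood_append]
          exact ⟨⟨hgood.1.1, nfGood_nfRhs hr⟩, hgood.2⟩
    · left
      obtain ⟨u, v, e, rfl, hu⟩ := exists_delayed_of_not_nfAdvanced hadv
      have hst : G.nf.StepOf π (Sum.inr e) (u ++ Sum.inl (Sum.inr e) :: v)
          (u ++ e.2.toList.map Sum.inr ++ v) :=
        stepOf_iff.2 ⟨u, v, fun _ => hu, by simp [nf], by simp [nf]⟩
      refine ⟨e, _, hst, nfForm_eq_of_nf_step_inr hst.step, Or.inl ?_⟩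
      intro p hp
      refine hgood p ?_
      simp only [List.mem_append, List.mem_map, List.mem_cons] at hp ⊢
      rcases hp with (hp | ⟨a, -, ha⟩) | hp
      · exact Or.inl hp
      · cases ha
      · exact Or.inr (Or.inr hp)
  · left
    have hst : G.nf.StepOf π (Sum.inr (q, none)) (u ++ Sum.inl (Sum.inr (q, none)) :: v)
        (u ++ v) :=
      stepOf_iff.2 ⟨u, v, hu, by simp [nf], by simp [nf]⟩
    exact ⟨(q, none), _, hst, nfForm_eq_of_nf_step_inr hst.step, Or.inl hgood⟩

/-- The simulation, run along an infinite derivation of `G`; `k j` is the number of steps of `G`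
simulated before time `j`. -/
theorem exists_nf_simulation {π : DerivMode} {s : ℕ → List (G.N ⊕ T)} {d : ℕ → G.P}
    (h0 : s 0 = [Sum.inl G.start]) (hs : ∀ i, G.StepOf π (d i) (s i) (s (i + 1))) :
    ∃ (s' : ℕ → List (G.NFN ⊕ T)) (d' : ℕ → G.nf.P) (k : ℕ → ℕ),
      s' 0 = [Sum.inl (Sum.inl G.start)] ∧ k 0 = 0 ∧
      (∀ j, G.nf.StepOf π (d' j) (s' j) (s' (j + 1))) ∧
      (∀ j, G.nfForm (s' j) = s (k j)) ∧
      ∀ j, (k (j + 1) = k j ∧ ∃ e, d' j = Sum.inr e) ∨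
        (k (j + 1) = k j + 1 ∧ d' j = Sum.inl (d (k j)) ∧
          termPrefix (s' j) = termPrefix (s (k j))) := by
  let St := {x : ℕ × List (G.NFN ⊕ T) // G.nfForm x.2 = s x.1 ∧ G.NFInv π x.2}
  have hnext : ∀ x : St, ∃ (p : G.nf.P) (y : St), G.nf.StepOf π p x.1.2 y.1.2 ∧
      ((y.1.1 = x.1.1 ∧ ∃ e, p = Sum.inr e) ∨
        (y.1.1 = x.1.1 + 1 ∧ p = Sum.inl (d x.1.1) ∧
          termPrefix x.1.2 = termPrefix (s x.1.1))) := by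
    rintro ⟨⟨i, x⟩, hx, hinv⟩
    dsimp only at hx hinv ⊢
    have hst := hs i
    rw [← hx] at hst
    rcases nf_simulate hinv hst with ⟨e, x', h1, h2, h3⟩ | ⟨x', h1, h2, h3, h4⟩
    · exact ⟨Sum.inr e, ⟨(i, x'), h2.trans hx, h3⟩, h1, Or.inl ⟨rfl, e, rfl⟩⟩
    · exact ⟨Sum.inl (d i), ⟨(i + 1, x'), h2, h3⟩, h1, Or.inr ⟨rfl, rfl, by rw [h4, hx]⟩⟩
  choose prod next hstep hcases using hnext
  let first : St := ⟨(0, [Sum.inl (Sum.inl G.start)]), by simp [h0], Or.inl (by simp [NFGood])⟩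
  let st : ℕ → St := fun n => next^[n] first
  have hst : ∀ j, st (j + 1) = next (st j) := fun j => Function.iterate_succ_apply' next j first
  refine ⟨fun j => (st j).1.2, fun j => prod (st j), fun j => (st j).1.1, rfl, rfl,
    fun j => ?_, fun j => (st j).2.1, fun j => ?_⟩
  · dsimp only
    rw [hst]
    exact hstep (st j)
  · dsimp only
    rw [hst]
    exact hcases (st j)

theorem lang_subset_nf (σ : AccSigma) (ρ : AccRho) (π : DerivMode) :
    G.Lang σ ρ π ⊆ G.nf.Lang σ ρ π := by
  rintro w ⟨s, d, h0, hs, hgrow, hmatch, hacc⟩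
  obtain ⟨s', d', k, h0', hk0, hs', hform, hcases⟩ := exists_nf_simulation h0 hs
  have hstep : ∀ i, G.nf.Step (d' i) (s' i) (s' (i + 1)) := fun i => (hs' i).step
  have hkle : ∀ j, k j ≤ j := by
    intro j
    induction j with
    | zero => omega
    | succ j ih => rcases hcases j with ⟨h, -⟩ | ⟨h, -⟩ <;> omega
  have hkmono : Monotone k :=
    monotone_nat_of_le_succ fun j => by rcases hcases j with ⟨h, -⟩ | ⟨h, -⟩ <;> omega
  have hlast : ∀ i, ∃ j, k j = i ∧ k (j + 1) = i + 1 := by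
    have hreach : ∀ i, ∃ j, k j = i := by
      intro i
      induction i with
      | zero => exact ⟨0, hk0⟩
      | succ i ih =>
        obtain ⟨j, rfl⟩ := ih
        by_contra! hcon
        have hconst : ∀ m, j ≤ m → k m = k j := by
          intro m hm
          induction m, hm using Nat.le_induction with
          | base => rfl
          | succ m _ ih =>
            rcases hcases m with ⟨h, -⟩ | ⟨h, -⟩
            · omega
            · exact absurd (by omega) (hcon (m + 1))
        obtain ⟨m, hm, q, hq⟩ := nf_exists_inl hstep j
        rcases hcases m with ⟨-, e, he⟩ | ⟨h, -⟩
        · rw [hq] at he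
          cases he
        · have h1 := hconst m hm
          have h2 := hconst (m + 1) (by omega)
          omega
    intro i
    have hex := hreach (i + 1)
    classical
    have hf := Nat.find_spec hex
    obtain ⟨j, hj⟩ : ∃ j, Nat.find hex = j + 1 := by
      refine Nat.exists_eq_succ_of_ne_zero fun hz => ?_
      rw [hz] at hf
      omega
    have hmin := Nat.find_min hex (m := j) (by omega)
    rw [hj] at hf
    refine ⟨j, ?_, hf⟩
    rcases hcases j with ⟨h, -⟩ | ⟨h, -⟩ <;> omega
  have hbase : ∀ i, ∃ j, k j = i ∧ d' j = Sum.inl (d i) ∧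
      termPrefix (s' j) = termPrefix (s i) := by
    intro i
    obtain ⟨j, rfl, hj⟩ := hlast i
    rcases hcases j with ⟨h, -⟩ | ⟨-, h⟩
    · omega
    · exact ⟨j, rfl, h⟩
  have hinl : ∀ j q, d' j = Sum.inl q → d (k j) = q := by
    intro j q hj
    rcases hcases j with ⟨-, e, he⟩ | ⟨-, h, -⟩
    · rw [hj] at he
      cases he
    · rw [hj] at h
      exact (Sum.inl.inj h).symm
  refine ⟨s', d', h0', hs', ?_, ?_, ?_⟩
  · intro n
    obtain ⟨i, hi⟩ := hgrow n
    obtain ⟨j, -, -, hj⟩ := hbase i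
    exact ⟨j, by rw [hj]; exact hi⟩
  · intro j
    refine (hmatch (k j)).of_prefix ?_
    rw [← hform j]
    exact G.termPrefix_prefix_nfForm (s' j)
  · have h1 : ∀ q, Sum.inl q ∈ sigmaSet σ d' ↔ q ∈ sigmaSet σ d := by
      intro q
      cases σ with
      | ran =>
        constructor
        · rintro ⟨j, hj⟩
          exact ⟨_, hinl j q hj⟩
        · rintro ⟨i, rfl⟩
          obtain ⟨j, -, hj, -⟩ := hbase i
          exact ⟨j, hj⟩
      | inf =>
        constructor
        · intro h n
          obtain ⟨j, hj, -⟩ := hbase n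
          obtain ⟨m, hm, hd⟩ := h j
          exact ⟨k m, hj ▸ hkmono hm, hinl m q hd⟩
        · intro h n
          obtain ⟨m, hm, rfl⟩ := h n
          obtain ⟨j, hj, hd, -⟩ := hbase m
          exact ⟨j, by have := hkle j; omega, hd⟩
    exact (nf_accepting_iff ρ h1
      fun q o h => (h1 q).1 (nf_sigmaSet_inr h0' hstep σ h)).2 hacc

end

end OmegaPSG

end OmegaFormal

/-- Lemma: every ω-PSG G has a (σ,ρ,π)-equivalent (for all modes) ω-PSG G'
whose productions are of the forms α → β (α,β ∈ N⁺), A → a, or A → ε. -/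
theorem psg_normal_form (T : Type) [Fintype T] (G : OmegaPSG T) :
    ∃ G' : OmegaPSG T,
      (∀ p : G'.P,
        (∃ β : List G'.N, β ≠ [] ∧ G'.rhs p = β.map Sum.inl) ∨
        ((G'.lhs p).length = 1 ∧ ∃ a : T, G'.rhs p = [Sum.inr a]) ∨
        ((G'.lhs p).length = 1 ∧ G'.rhs p = [])) ∧
      ∀ (σ : AccSigma) (ρ : AccRho) (π : DerivMode),
        G.Lang σ ρ π = G'.Lang σ ρ π := by
  refine ⟨G.nf, ?_, fun σ ρ π =>
    Set.Subset.antisymm (OmegaPSG.lang_subset_nf σ ρ π) (OmegaPSG.nf_lang_subset σ ρ π)⟩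
  rintro (p | ⟨p, _ | a⟩)
  · refine Or.inl ⟨G.nfRhs p, ?_, rfl⟩
    unfold OmegaPSG.nfRhs
    split <;> simp
  · exact Or.inr (Or.inr ⟨rfl, rfl⟩)
  · exact Or.inr (Or.inl ⟨rfl, a, rfl⟩)
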